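/- Let (T^(n))_{n≥1} and (T'^(n))_{n≥1} be two sequences of N×N row-stochastic matrices with all entries positive, with (T^(n)) satisfying the quasi-stationary condition Σ_{n=1}^∞ |T^(n)_{i,j}/T^(n+1)_{i,j} − 1| < ∞ for all i,j ∈ Z_N, and suppose that Σ_{n=1}^∞ |T^(n)_{i,j} − T'^(n)_{i,j}| < ∞ for every i,j ∈ Z_N. Then for every x = x₁x₂… ∈ K_N, Σ_{n=1}^∞ |T'^(n)_{x_n,x_{n+1}} / T^(n)_{x_n,x_{n+1}} − 1| < ∞; consequently the infinite product ∏_{n=1}^∞ T'^(n)_{x_n,x_{n+1}} / T^(n)_{x_n,x_{n+1}} converges to a finite positive number for every x ∈ K_N. -/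

import Mathlib

open Filter Finset

/-- Real numbers `b n` with `∑ |b n - 1| < ∞` have summable logarithms. -/
theorem summable_log_of_summable_abs_sub_one {b : ℕ → ℝ}
    (h : Summable fun n => |b n - 1|) : Summable fun n => Real.log (b n) := by
  simpa using Real.summable_log_one_add_of_summable h.of_abs

/-- The partial products of positive numbers `b n` with `∑ |b n - 1| < ∞` converge to a positive
limit. -/
theorem exists_pos_tendsto_prod_of_summable_abs_sub_one {b : ℕ → ℝ} (hb : ∀ n, 0 < b n)
    (h : Summable fun n => |b n - 1|) :
    ∃ L : ℝ, 0 < L ∧ Tendsto (fun n => ∏ k ∈ Finset.range n, b k) atTop (nhds L) := by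
  refine ⟨_, Real.exp_pos _, ((Real.continuous_exp.tendsto _).comp
    (summable_log_of_summable_abs_sub_one h).hasSum.tendsto_sum_nat).congr fun n => ?_⟩
  simp only [Function.comp_apply, Real.exp_sum, Real.exp_log (hb _)]

/-- A positive sequence whose successive ratios `a n / a (n + 1)` are summably close to `1` is
bounded away from zero. -/
theorem exists_pos_le_of_summable_ratio {a : ℕ → ℝ} (ha : ∀ n, 0 < a n)
    (h : Summable fun n => |a n / a (n + 1) - 1|) : ∃ c : ℝ, 0 < c ∧ ∀ n, c ≤ a n := by
  obtain ⟨L, -, hL⟩ := exists_pos_tendsto_prod_of_summable_abs_sub_one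
    (fun n => div_pos (ha n) (ha (n + 1))) h
  obtain ⟨M, hM⟩ := hL.bddAbove_range
  have hprod : ∀ n, ∏ k ∈ Finset.range n, a k / a (k + 1) = a 0 / a n := by
    intro n
    induction n with
    | zero => simp [(ha 0).ne']
    | succ k ih => rw [Finset.prod_range_succ, ih, div_mul_div_cancel₀ (ha k).ne']
  have hle : ∀ n, a 0 / a n ≤ M := fun n => hprod n ▸ hM ⟨n, rfl⟩
  have hM0 : 0 < M := (div_pos (ha 0) (ha 0)).trans_le (hle 0)
  exact ⟨a 0 / M, div_pos (ha 0) hM0, fun n => (div_le_comm₀ (ha n) hM0).mp (hle n)⟩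

/-- If `(T^(n))` is quasi-stationary and `Σ_n |T^(n)_{i,j} - T'^(n)_{i,j}| < ∞`
for all `i, j`, then along every infinite word `x` the series
`Σ_n |T'^(n)_{x_n,x_{n+1}} / T^(n)_{x_n,x_{n+1}} - 1|` converges, and consequently the
infinite product `∏_n T'^(n)_{x_n,x_{n+1}} / T^(n)_{x_n,x_{n+1}}` converges to a finite
positive number. -/
theorem ratio_product_converges_of_summable_diff (N : ℕ) (hN : 2 ≤ N)
    (T T' : ℕ → Matrix (Fin N) (Fin N) ℝ)
    (hpos : ∀ n i j, 0 < T n i j)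
    (hstoch : ∀ n i, ∑ j, T n i j = 1)
    (hpos' : ∀ n i j, 0 < T' n i j)
    (hstoch' : ∀ n i, ∑ j, T' n i j = 1)
    (hqs : ∀ i j : Fin N, Summable fun n => |T n i j / T (n + 1) i j - 1|)
    (hdiff : ∀ i j : Fin N, Summable fun n => |T n i j - T' n i j|) :
    ∀ x : ℕ → Fin N,
      (Summable fun n => |T' n (x n) (x (n + 1)) / T n (x n) (x (n + 1)) - 1|) ∧
      ∃ L : ℝ, 0 < L ∧
        Tendsto (fun n => ∏ k ∈ Finset.range n,
          T' k (x k) (x (k + 1)) / T k (x k) (x (k + 1))) atTop (nhds L) := by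
  intro x
  have hentry : ∀ i j, Summable fun n => |T' n i j / T n i j - 1| := fun i j => by
    obtain ⟨c, hc, hle⟩ := exists_pos_le_of_summable_ratio (fun n => hpos n i j) (hqs i j)
    refine ((hdiff i j).div_const c).of_nonneg_of_le (fun n => abs_nonneg _) fun n => ?_
    rw [div_sub_one (hpos n i j).ne', abs_div, abs_of_pos (hpos n i j), abs_sub_comm]
    exact div_le_div_of_nonneg_left (abs_nonneg _) hc (hle n)
  have hsum : Summable fun n => |T' n (x n) (x (n + 1)) / T n (x n) (x (n + 1)) - 1| := by
    have hall : Summable fun n => ∑ p : Fin N × Fin N, |T' n p.1 p.2 / T n p.1 p.2 - 1| :=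
      summable_sum fun p _ => hentry p.1 p.2
    exact hall.of_nonneg_of_le (fun n => abs_nonneg _) fun n =>
      Finset.single_le_sum (f := fun p : Fin N × Fin N => |T' n p.1 p.2 / T n p.1 p.2 - 1|)
        (fun p _ => abs_nonneg _) (Finset.mem_univ (x n, x (n + 1)))
  exact ⟨hsum, exists_pos_tendsto_prod_of_summable_abs_sub_one
    (fun n => div_pos (hpos' n _ _) (hpos n _ _)) hsum⟩
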